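/- Let d ≥ 1 and S ≥ 1, let V : ℝ^d → ℝ^d be continuously differentiable, and for ε ∈ ℝ let φ_ε(x) = x + ε V(x). Suppose ψ : ℝ × ℝ^d → ℝ^d is twice continuously differentiable on a neighborhood of {0} × ℝ^d with ψ(0, y) = y for all y and φ_ε(ψ(ε, y)) = y for all y and all ε near 0. For s = 1,…,S let N_s : ℝ^d → ℝ be twice continuously differentiable and let g_s : ℝ → ℝ be differentiable at ε = 0. Define g_ε(y) = Σ_{s=1}^S g_s(ε) N_s(ψ(ε, y)) and write g(y) = g_0(y) = Σ_s g_s(0) N_s(y). Then for each fixed x ∈ ℝ^d the map ε ↦ (∇_y g_ε)(x) is differentiable at ε = 0 with derivative D(∇g)[V](x) = Σ_{s=1}^S g_s′(0) ∇N_s(x) − (∇V(x))ᵀ ( Σ_{s=1}^S g_s(0) ∇N_s(x) ) − [ ∇( Σ_{s=1}^S g_s(0) ∇N_s ) (x) ] V(x), where ∇V denotes the Jacobian matrix of V and the last term is the Hessian of g at x applied to V(x). -/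

import Mathlib

open Filter

/-- the inverse Riesz map as a real continuous linear map -/
theorem shapeAux_riesz (d : ℕ) : ∃ T : (EuclideanSpace ℝ (Fin d) →L[ℝ] ℝ) →L[ℝ] EuclideanSpace ℝ (Fin d),
    ∀ L, T L = (InnerProductSpace.toDual ℝ (EuclideanSpace ℝ (Fin d))).symm L := by
  refine ⟨LinearMap.toContinuousLinearMap
    { toFun := fun L => (InnerProductSpace.toDual ℝ (EuclideanSpace ℝ (Fin d))).symm L
      map_add' := fun a b => map_add _ a b
      map_smul' := fun c a => by simp }, fun L => rfl⟩

theorem shapeAux_smul {F : Type*} [NormedAddCommGroup F] [NormedSpace ℝ F] (h : ℝ → F)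
    (hc : ContinuousAt h 0) : HasDerivAt (fun ε : ℝ => ε • h ε) (h 0) 0 := by
  rw [hasDerivAt_iff_tendsto_slope]
  refine (hc.tendsto.mono_left nhdsWithin_le_nhds).congr' ?_
  filter_upwards [self_mem_nhdsWithin] with ε hε
  have hε : ε ≠ 0 := hε
  simp [slope, smul_smul, hε]

theorem shapeAux_adj (d : ℕ) (A : EuclideanSpace ℝ (Fin d) →L[ℝ] EuclideanSpace ℝ (Fin d))
    (L : EuclideanSpace ℝ (Fin d) →L[ℝ] ℝ) :
    (InnerProductSpace.toDual ℝ (EuclideanSpace ℝ (Fin d))).symm (L.comp A) =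
      (ContinuousLinearMap.adjoint A)
        ((InnerProductSpace.toDual ℝ (EuclideanSpace ℝ (Fin d))).symm L) := by
  refine ext_inner_right ℝ fun v => ?_
  rw [ContinuousLinearMap.adjoint_inner_left, InnerProductSpace.toDual_symm_apply,
    InnerProductSpace.toDual_symm_apply]
  rfl

/-- shape derivative of the gradient of a finite element function: for the
transported finite element function `g_ε(y) = Σ_s g_s(ε) N_s(ψ(ε, y))`, the map
`ε ↦ ∇g_ε(x)` is differentiable at `ε = 0` with derivative
`Σ_s g_s′(0) ∇N_s(x) − (∇V(x))ᵀ (Σ_s g_s(0) ∇N_s(x)) − ∇(Σ_s g_s(0) ∇N_s)(x) V(x)`. -/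
theorem shape_derivative_gradient_finite_element_function
    (d S : ℕ) (hd : 1 ≤ d) (hS : 1 ≤ S)
    (V : EuclideanSpace ℝ (Fin d) → EuclideanSpace ℝ (Fin d)) (hV : ContDiff ℝ 1 V)
    (ψ : ℝ → EuclideanSpace ℝ (Fin d) → EuclideanSpace ℝ (Fin d))
    (hψC2 : ∃ U : Set (ℝ × EuclideanSpace ℝ (Fin d)), IsOpen U ∧
      (∀ y, ((0 : ℝ), y) ∈ U) ∧ ContDiffOn ℝ 2 (fun z => ψ z.1 z.2) U)
    (hψ0 : ∀ y, ψ 0 y = y)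
    (hψinv : ∀ᶠ ε in nhds (0 : ℝ), ∀ y, ψ ε y + ε • V (ψ ε y) = y)
    (N : Fin S → EuclideanSpace ℝ (Fin d) → ℝ)
    (hN : ∀ s, ContDiff ℝ 2 (N s))
    (g : Fin S → ℝ → ℝ)
    (hg : ∀ s, DifferentiableAt ℝ (g s) 0)
    (x : EuclideanSpace ℝ (Fin d)) :
    HasDerivAt (fun ε => gradient (fun y => ∑ s : Fin S, g s ε * N s (ψ ε y)) x)
      ((∑ s : Fin S, deriv (g s) 0 • gradient (N s) x)
        - (ContinuousLinearMap.adjoint (fderiv ℝ V x))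
            (∑ s : Fin S, g s 0 • gradient (N s) x)
        - fderiv ℝ (fun y => ∑ s : Fin S, g s 0 • gradient (N s) y) x (V x)) 0 := by
  obtain ⟨U, hUo, hU0, hΨ⟩ := hψC2
  obtain ⟨T, hT⟩ := shapeAux_riesz d
  -- the joint map is C² near (0, x)
  have hΨx : ContDiffAt ℝ 2 (fun z : ℝ × EuclideanSpace ℝ (Fin d) => ψ z.1 z.2) (0, x) :=
    hΨ.contDiffAt (hUo.mem_nhds (hU0 x))
  have hι : Continuous (fun ε : ℝ => (ε, x)) := by fun_prop
  have hmem : ∀ᶠ ε in nhds (0 : ℝ), (ε, x) ∈ U :=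
    hι.continuousAt.eventually (hUo.mem_nhds (hU0 x))
  set A : ℝ → EuclideanSpace ℝ (Fin d) →L[ℝ] EuclideanSpace ℝ (Fin d) := fun ε =>
    (fderiv ℝ (fun z : ℝ × EuclideanSpace ℝ (Fin d) => ψ z.1 z.2) (ε, x)).comp
      (ContinuousLinearMap.inr ℝ ℝ (EuclideanSpace ℝ (Fin d))) with hA
  have hAd : ∀ᶠ ε in nhds (0 : ℝ), HasFDerivAt (ψ ε) (A ε) x := by
    filter_upwards [hmem] with ε hε
    have h1 : HasFDerivAt (fun z : ℝ × EuclideanSpace ℝ (Fin d) => ψ z.1 z.2) _ (ε, x) :=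
      ((hΨ.contDiffAt (hUo.mem_nhds hε)).differentiableAt (by norm_num)).hasFDerivAt
    exact h1.comp x (hasFDerivAt_prodMk_right ε x)
  have hA0 : A 0 = ContinuousLinearMap.id ℝ _ := by
    have h1 := hAd.self_of_nhds
    have h2 : ψ 0 = id := funext hψ0
    rw [h2] at h1
    exact h1.unique (hasFDerivAt_id x)
  have hAc : ContinuousAt A 0 := by
    have h1 : ContinuousAt (fderiv ℝ (fun z : ℝ × EuclideanSpace ℝ (Fin d) => ψ z.1 z.2)) (0, x) :=
      (hΨx.fderiv_right (m := 1) (by norm_num)).continuousAt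
    have h2 : ContinuousAt (fun ε : ℝ =>
        fderiv ℝ (fun z : ℝ × EuclideanSpace ℝ (Fin d) => ψ z.1 z.2) (ε, x)) 0 :=
      ContinuousAt.comp (f := fun ε : ℝ => (ε, x)) h1 hι.continuousAt
    exact h2.clm_comp continuousAt_const
  have hpc : ContinuousAt (fun ε => ψ ε x) 0 :=
    ContinuousAt.comp (f := fun ε : ℝ => (ε, x)) hΨx.continuousAt hι.continuousAt
  -- derivative of the point
  have hVd : Differentiable ℝ V := hV.differentiable (by norm_num)
  have hp : HasDerivAt (fun ε => ψ ε x) (-V x) 0 := by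
    have h1 : ContinuousAt (fun ε => V (ψ ε x)) 0 :=
      ContinuousAt.comp (g := V) hV.continuous.continuousAt hpc
    have h2 := (shapeAux_smul _ h1).const_sub x
    simp only [hψ0] at h2
    refine h2.congr_of_eventuallyEq ?_
    filter_upwards [hψinv] with ε hε
    exact eq_sub_of_add_eq (hε x)
  -- derivative of the Jacobian
  have hAder : HasDerivAt A (-fderiv ℝ V x) 0 := by
    have h0 : ContinuousAt (fun ε => fderiv ℝ V (ψ ε x)) 0 :=
      ContinuousAt.comp (g := fderiv ℝ V)
        (hV.continuous_fderiv (by norm_num)).continuousAt hpc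
    have h1 : ContinuousAt (fun ε => (fderiv ℝ V (ψ ε x)).comp (A ε)) 0 := h0.clm_comp hAc
    have h2 := (shapeAux_smul _ h1).const_sub (ContinuousLinearMap.id ℝ _)
    simp only [hψ0, hA0, ContinuousLinearMap.comp_id] at h2
    refine h2.congr_of_eventuallyEq ?_
    filter_upwards [hψinv, hAd] with ε hε hεA
    have h3 := hεA.add (((hVd (ψ ε x)).hasFDerivAt.comp x hεA).const_smul ε)
    have h4 : (ψ ε + ε • (V ∘ ψ ε)) = id := funext hε
    rw [h4] at h3
    exact eq_sub_of_add_eq (h3.unique (hasFDerivAt_id x))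
  have hNd : ∀ s, Differentiable ℝ (N s) := fun s => (hN s).differentiable (by norm_num)
  have hNdd : ∀ s, Differentiable ℝ (fderiv ℝ (N s)) := fun s =>
    ((hN s).fderiv_right (m := 1) (by norm_num)).differentiable (by norm_num)
  -- derivative of the differential
  have hF : HasDerivAt (fun ε => ∑ s : Fin S, g s ε • (fderiv ℝ (N s) (ψ ε x)).comp (A ε))
      (∑ s : Fin S, (g s 0 • ((fderiv ℝ (fderiv ℝ (N s)) x (-V x)) +
        (fderiv ℝ (N s) x).comp (-fderiv ℝ V x)) + deriv (g s) 0 • fderiv ℝ (N s) x)) 0 := by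
    refine HasDerivAt.fun_sum fun s _ => ?_
    have h1 : HasDerivAt (fun ε => fderiv ℝ (N s) (ψ ε x))
        (fderiv ℝ (fderiv ℝ (N s)) x (-V x)) 0 := by
      refine HasFDerivAt.comp_hasDerivAt (l := fderiv ℝ (N s)) 0 ?_ hp
      rw [hψ0]
      exact (hNdd s x).hasFDerivAt
    have h2 := (hg s).hasDerivAt.fun_smul (h1.clm_comp hAder)
    simpa only [hψ0, hA0, ContinuousLinearMap.comp_id] using h2
  have hTF := T.hasFDerivAt.comp_hasDerivAt 0 hF
  have hgrad : ∀ s y, gradient (N s) y = T (fderiv ℝ (N s) y) := fun s y => (hT _).symm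
  have hH : fderiv ℝ (fun y => ∑ s : Fin S, g s 0 • gradient (N s) y) x (V x) =
      ∑ s : Fin S, g s 0 • T (fderiv ℝ (fderiv ℝ (N s)) x (V x)) := by
    have h1 : HasFDerivAt (fun y => ∑ s : Fin S, g s 0 • gradient (N s) y)
        (∑ s : Fin S, g s 0 • T.comp (fderiv ℝ (fderiv ℝ (N s)) x)) x := by
      refine HasFDerivAt.fun_sum fun s _ => ?_
      simp only [hgrad]
      exact (T.hasFDerivAt.comp x (hNdd s x).hasFDerivAt).const_smul (g s 0)
    rw [h1.fderiv]
    simp [ContinuousLinearMap.sum_apply]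
  have hadj : ∀ L : EuclideanSpace ℝ (Fin d) →L[ℝ] ℝ, T (L.comp (fderiv ℝ V x)) =
      (ContinuousLinearMap.adjoint (fderiv ℝ V x)) (T L) := fun L => by
    rw [hT, hT, shapeAux_adj]
  refine (hTF.congr_of_eventuallyEq ?_).congr_deriv ?_
  · filter_upwards [hAd] with ε hε
    have h1 : HasFDerivAt (fun y => ∑ s : Fin S, g s ε * N s (ψ ε y))
        (∑ s : Fin S, g s ε • (fderiv ℝ (N s) (ψ ε x)).comp (A ε)) x := by
      refine HasFDerivAt.fun_sum fun s _ => ?_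
      exact ((hNd s (ψ ε x)).hasFDerivAt.comp x hε).const_mul (g s ε)
    simp only [gradient, h1.fderiv, Function.comp, hT]
  · rw [hH]
    simp only [hgrad, map_sum, map_add, map_smul, map_neg, ContinuousLinearMap.comp_neg, hadj,
      smul_add, smul_neg, Finset.sum_add_distrib, Finset.sum_neg_distrib]
    abel
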